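/- Let A be a nonzero m×n real matrix with singular values σ₁(A) ≥ σ₂(A) ≥ …, and let u₁, v₁ be a leading left and right singular vector pair. Then: (i) the set of optimal solutions of the problem: minimize ‖X‖_* subject to ⟨A,X⟩ ≥ 1, equals ‖A‖⁻¹ · ∂‖A‖, the subdifferential of the spectral norm at A scaled by the reciprocal of the spectral norm of A; (ii) the scaled best rank-one approximation X = u₁v₁ᵀ/σ₁(A) is an optimal solution, and it is the unique optimal solution if and only if σ₁(A) > σ₂(A). -/

import Mathlib

open scoped BigOperators Pointwise

noncomputable section

namespace LAROS

variable {m n : ℕ}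

/-- Trace inner product `⟨A,X⟩ = trace(Aᵀ X)`. -/
def mInner (A X : Matrix (Fin m) (Fin n) ℝ) : ℝ := ∑ i, ∑ j, A i j * X i j

/-- `N` is a norm on `m×n` real matrices. -/
def IsMatrixNorm (N : Matrix (Fin m) (Fin n) ℝ → ℝ) : Prop :=
  (∀ X, N X = 0 ↔ X = 0) ∧ (∀ (c : ℝ) (X), N (c • X) = |c| * N X) ∧
    (∀ X Y, N (X + Y) ≤ N X + N Y)

/-- Dual norm of `N`. -/
def dualNorm (N : Matrix (Fin m) (Fin n) ℝ → ℝ) (A : Matrix (Fin m) (Fin n) ℝ) : ℝ :=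
  sSup {r | ∃ Y, N Y ≤ 1 ∧ r = mInner A Y}

/-- `X` is optimal for: minimize `N X` subject to `⟨A,X⟩ ≥ 1`. -/
def IsOptMin (N : Matrix (Fin m) (Fin n) ℝ → ℝ) (A X : Matrix (Fin m) (Fin n) ℝ) : Prop :=
  1 ≤ mInner A X ∧ ∀ X', 1 ≤ mInner A X' → N X ≤ N X'

/-- `Y` is optimal for: maximize `⟨A,Y⟩` subject to `N Y ≤ 1`. -/
def IsOptMax (N : Matrix (Fin m) (Fin n) ℝ → ℝ) (A Y : Matrix (Fin m) (Fin n) ℝ) : Prop :=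
  N Y ≤ 1 ∧ ∀ Y', N Y' ≤ 1 → mInner A Y' ≤ mInner A Y

/-- Subdifferential of `f : ℝ^{m×n} → ℝ` at `A`, with respect to the trace inner product. -/
def subdiff (f : Matrix (Fin m) (Fin n) ℝ → ℝ) (A : Matrix (Fin m) (Fin n) ℝ) :
    Set (Matrix (Fin m) (Fin n) ℝ) :=
  {Y | ∀ B, f A + mInner (B - A) Y ≤ f B}

/-- The spectral norm (largest singular value) of an `m×n` real matrix:
`σ₁(A) = max { uᵀ A v : ‖u‖₂ ≤ 1, ‖v‖₂ ≤ 1 }`. -/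
def spectralNorm (A : Matrix (Fin m) (Fin n) ℝ) : ℝ :=
  sSup {r | ∃ (u : Fin m → ℝ) (v : Fin n → ℝ),
    (∑ i, u i ^ 2) ≤ 1 ∧ (∑ j, v j ^ 2) ≤ 1 ∧ r = ∑ i, ∑ j, u i * A i j * v j}

/-- The nuclear norm (sum of singular values), as the dual norm of the spectral norm. -/
def nuclearNorm (A : Matrix (Fin m) (Fin n) ℝ) : ℝ := dualNorm spectralNorm A

/-- The second largest singular value, via best rank-one approximation:
`σ₂(A) = min { ‖A - S‖ : rank S ≤ 1 }`. -/
def sigma2 (A : Matrix (Fin m) (Fin n) ℝ) : ℝ :=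
  sInf {r | ∃ S : Matrix (Fin m) (Fin n) ℝ, S.rank ≤ 1 ∧ r = spectralNorm (A - S)}

open Matrix

lemma mInner_comm (A X : Matrix (Fin m) (Fin n) ℝ) : mInner A X = mInner X A := by
  simp only [mInner, mul_comm]

lemma mInner_add_left (A B X : Matrix (Fin m) (Fin n) ℝ) :
    mInner (A + B) X = mInner A X + mInner B X := by
  simp only [mInner, Matrix.add_apply, add_mul, Finset.sum_add_distrib]

lemma mInner_sub_left (A B X : Matrix (Fin m) (Fin n) ℝ) :
    mInner (A - B) X = mInner A X - mInner B X := by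
  simp only [mInner, Matrix.sub_apply, sub_mul, Finset.sum_sub_distrib]

lemma mInner_smul_left (c : ℝ) (A X : Matrix (Fin m) (Fin n) ℝ) :
    mInner (c • A) X = c * mInner A X := by
  simp only [mInner, Matrix.smul_apply, smul_eq_mul, Finset.mul_sum, mul_assoc]

lemma mInner_smul_right (c : ℝ) (A X : Matrix (Fin m) (Fin n) ℝ) :
    mInner A (c • X) = c * mInner A X := by
  rw [mInner_comm, mInner_smul_left, mInner_comm]

lemma sum_sum_mul_eq_dotProduct_mulVec (A : Matrix (Fin m) (Fin n) ℝ) (u : Fin m → ℝ)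
    (v : Fin n → ℝ) : ∑ i, ∑ j, u i * A i j * v j = u ⬝ᵥ A *ᵥ v := by
  simp only [dotProduct, mulVec, Finset.mul_sum, mul_assoc]

lemma mInner_vecMulVec (u : Fin m → ℝ) (v : Fin n → ℝ) (Y : Matrix (Fin m) (Fin n) ℝ) :
    mInner (vecMulVec u v) Y = u ⬝ᵥ Y *ᵥ v := by
  rw [← sum_sum_mul_eq_dotProduct_mulVec]
  simp only [mInner, vecMulVec_apply, mul_right_comm]

lemma sum_sq_eq_dotProduct_self {k : ℕ} (u : Fin k → ℝ) : ∑ i, u i ^ 2 = u ⬝ᵥ u := by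
  simp only [dotProduct, sq]

lemma dotProduct_self_nonneg_real {k : ℕ} (u : Fin k → ℝ) : 0 ≤ u ⬝ᵥ u := by
  rw [← sum_sq_eq_dotProduct_self]
  positivity

lemma mInner_self_nonneg (Y : Matrix (Fin m) (Fin n) ℝ) : 0 ≤ mInner Y Y :=
  Finset.sum_nonneg fun _ _ ↦ Finset.sum_nonneg fun _ _ ↦ mul_self_nonneg _

lemma eq_zero_of_mInner_self_le_zero {Y : Matrix (Fin m) (Fin n) ℝ} (h : mInner Y Y ≤ 0) :
    Y = 0 := by
  have h0 := le_antisymm h (mInner_self_nonneg Y)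
  ext i j
  have hi := (Finset.sum_eq_zero_iff_of_nonneg fun i _ ↦
    Finset.sum_nonneg fun j _ ↦ mul_self_nonneg (Y i j)).1 h0 i (Finset.mem_univ i)
  have hij := (Finset.sum_eq_zero_iff_of_nonneg fun j _ ↦ mul_self_nonneg (Y i j)).1 hi j
    (Finset.mem_univ j)
  simpa using hij

/-- Bilinear forms on the unit balls are bounded by the Frobenius norm. -/
lemma dotProduct_mulVec_le_sqrt_mInner_self (A : Matrix (Fin m) (Fin n) ℝ) {u : Fin m → ℝ}
    {v : Fin n → ℝ} (hu : u ⬝ᵥ u ≤ 1) (hv : v ⬝ᵥ v ≤ 1) :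
    u ⬝ᵥ A *ᵥ v ≤ √(mInner A A) := by
  apply Real.le_sqrt_of_sq_le
  have h := Finset.sum_mul_sq_le_sq_mul_sq (Finset.univ : Finset (Fin m × Fin n))
    (fun p ↦ u p.1 * v p.2) (fun p ↦ A p.1 p.2)
  simp only [Fintype.sum_prod_type] at h
  have h1 : ∑ i, ∑ j, u i * v j * A i j = u ⬝ᵥ A *ᵥ v := by
    rw [← sum_sum_mul_eq_dotProduct_mulVec]
    simp only [mul_right_comm]
  have h2 : ∑ i, ∑ j, (u i * v j) ^ 2 = (u ⬝ᵥ u) * (v ⬝ᵥ v) := by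
    rw [← sum_sq_eq_dotProduct_self, ← sum_sq_eq_dotProduct_self, Finset.sum_mul_sum]
    simp only [mul_pow]
  have h3 : ∑ i, ∑ j, A i j ^ 2 = mInner A A := by simp only [mInner, sq]
  rw [h1, h2, h3] at h
  refine h.trans (mul_le_of_le_one_left (mInner_self_nonneg A) ?_)
  exact mul_le_one₀ hu (dotProduct_self_nonneg_real v) hv

lemma dotProduct_mulVec_le_spectralNorm (A : Matrix (Fin m) (Fin n) ℝ) {u : Fin m → ℝ}
    {v : Fin n → ℝ} (hu : u ⬝ᵥ u ≤ 1) (hv : v ⬝ᵥ v ≤ 1) :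
    u ⬝ᵥ A *ᵥ v ≤ spectralNorm A := by
  refine le_csSup ⟨√(mInner A A), ?_⟩ ⟨u, v, ?_, ?_, ?_⟩
  · rintro _ ⟨u, v, hu, hv, rfl⟩
    rw [sum_sq_eq_dotProduct_self] at hu hv
    rw [sum_sum_mul_eq_dotProduct_mulVec]
    exact dotProduct_mulVec_le_sqrt_mInner_self A hu hv
  · rwa [sum_sq_eq_dotProduct_self]
  · rwa [sum_sq_eq_dotProduct_self]
  · rw [sum_sum_mul_eq_dotProduct_mulVec]

lemma spectralNorm_le {A : Matrix (Fin m) (Fin n) ℝ} {c : ℝ}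
    (h : ∀ u v, u ⬝ᵥ u ≤ 1 → v ⬝ᵥ v ≤ 1 → u ⬝ᵥ A *ᵥ v ≤ c) : spectralNorm A ≤ c := by
  refine csSup_le ⟨0, 0, 0, by simp, by simp, by simp⟩ ?_
  rintro _ ⟨u, v, hu, hv, rfl⟩
  rw [sum_sq_eq_dotProduct_self] at hu hv
  rw [sum_sum_mul_eq_dotProduct_mulVec]
  exact h u v hu hv

lemma spectralNorm_nonneg (A : Matrix (Fin m) (Fin n) ℝ) : 0 ≤ spectralNorm A := by
  simpa using dotProduct_mulVec_le_spectralNorm A (u := 0) (v := 0) (by simp) (by simp)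

lemma spectralNorm_le_sqrt_mInner_self (A : Matrix (Fin m) (Fin n) ℝ) :
    spectralNorm A ≤ √(mInner A A) :=
  spectralNorm_le fun _ _ ↦ dotProduct_mulVec_le_sqrt_mInner_self A

lemma spectralNorm_add_le (A B : Matrix (Fin m) (Fin n) ℝ) :
    spectralNorm (A + B) ≤ spectralNorm A + spectralNorm B :=
  spectralNorm_le fun u v hu hv ↦ by
    rw [add_mulVec, dotProduct_add]
    exact add_le_add (dotProduct_mulVec_le_spectralNorm A hu hv)
      (dotProduct_mulVec_le_spectralNorm B hu hv)

lemma spectralNorm_smul_le {c : ℝ} (hc : 0 ≤ c) (A : Matrix (Fin m) (Fin n) ℝ) :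
    spectralNorm (c • A) ≤ c * spectralNorm A :=
  spectralNorm_le fun u v hu hv ↦ by
    rw [smul_mulVec, dotProduct_smul, smul_eq_mul]
    exact mul_le_mul_of_nonneg_left (dotProduct_mulVec_le_spectralNorm A hu hv) hc

lemma spectralNorm_zero : spectralNorm (0 : Matrix (Fin m) (Fin n) ℝ) = 0 :=
  le_antisymm (spectralNorm_le fun u v _ _ ↦ by simp) (spectralNorm_nonneg _)

lemma abs_apply_le_spectralNorm (A : Matrix (Fin m) (Fin n) ℝ) (i : Fin m) (j : Fin n) :
    |A i j| ≤ spectralNorm A := by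
  rw [abs_le']
  constructor
  · simpa using dotProduct_mulVec_le_spectralNorm A (u := Pi.single i 1) (v := Pi.single j 1)
      (by simp) (by simp)
  · simpa using dotProduct_mulVec_le_spectralNorm A (u := -Pi.single i 1) (v := Pi.single j 1)
      (by simp) (by simp)

lemma spectralNorm_pos {A : Matrix (Fin m) (Fin n) ℝ} (hA : A ≠ 0) : 0 < spectralNorm A := by
  refine (spectralNorm_nonneg A).lt_of_ne fun h ↦ hA ?_
  ext i j
  simpa [← h] using abs_apply_le_spectralNorm A i j

lemma two_mul_dotProduct_mulVec_le (A : Matrix (Fin m) (Fin n) ℝ) (u : Fin m → ℝ)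
    (v : Fin n → ℝ) : 2 * (u ⬝ᵥ A *ᵥ v) ≤ spectralNorm A * (u ⬝ᵥ u + v ⬝ᵥ v) := by
  have hu0 := dotProduct_self_nonneg_real u
  have hv0 := dotProduct_self_nonneg_real v
  rcases hu0.eq_or_lt with hu | hu
  · rw [dotProduct_self_eq_zero.1 hu.symm]
    simpa using mul_nonneg (spectralNorm_nonneg A) hv0
  rcases hv0.eq_or_lt with hv | hv
  · rw [dotProduct_self_eq_zero.1 hv.symm]
    simpa using mul_nonneg (spectralNorm_nonneg A) hu0
  have hs := Real.sqrt_pos.2 hu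
  have ht := Real.sqrt_pos.2 hv
  have hs2 := Real.sq_sqrt hu0
  have ht2 := Real.sq_sqrt hv0
  set s := √(u ⬝ᵥ u)
  set t := √(v ⬝ᵥ v)
  have h := dotProduct_mulVec_le_spectralNorm A (u := s⁻¹ • u) (v := t⁻¹ • v)
    (by simp only [smul_dotProduct, dotProduct_smul, smul_eq_mul, ← hs2]; field_simp; rfl)
    (by simp only [smul_dotProduct, dotProduct_smul, smul_eq_mul, ← ht2]; field_simp; rfl)
  simp only [mulVec_smul, smul_dotProduct, dotProduct_smul, smul_eq_mul] at h
  have h' : u ⬝ᵥ A *ᵥ v ≤ spectralNorm A * (s * t) := by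
    field_simp at h
    linarith
  have := mul_nonneg (spectralNorm_nonneg A) (sq_nonneg (s - t))
  rw [← hs2, ← ht2]
  linarith

lemma mInner_le_nuclearNorm (X : Matrix (Fin m) (Fin n) ℝ) {Y : Matrix (Fin m) (Fin n) ℝ}
    (hY : spectralNorm Y ≤ 1) : mInner X Y ≤ nuclearNorm X := by
  refine le_csSup ⟨∑ i, ∑ j, |X i j|, ?_⟩ ⟨Y, hY, rfl⟩
  rintro _ ⟨Y, hY, rfl⟩
  refine Finset.sum_le_sum fun i _ ↦ Finset.sum_le_sum fun j _ ↦ ?_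
  refine (le_abs_self _).trans ?_
  rw [abs_mul]
  exact mul_le_of_le_one_right (abs_nonneg _) ((abs_apply_le_spectralNorm Y i j).trans hY)

lemma nuclearNorm_le {X : Matrix (Fin m) (Fin n) ℝ} {c : ℝ}
    (h : ∀ Y, spectralNorm Y ≤ 1 → mInner X Y ≤ c) : nuclearNorm X ≤ c := by
  refine csSup_le ⟨mInner X 0, 0, by simp [spectralNorm_zero], rfl⟩ ?_
  rintro _ ⟨Y, hY, rfl⟩
  exact h Y hY

lemma mInner_le_nuclearNorm_mul_spectralNorm (X Y : Matrix (Fin m) (Fin n) ℝ) :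
    mInner X Y ≤ nuclearNorm X * spectralNorm Y := by
  rcases eq_or_ne Y 0 with rfl | hY
  · simp [mInner, spectralNorm_zero]
  have hpos := spectralNorm_pos hY
  have h := mInner_le_nuclearNorm X (Y := (spectralNorm Y)⁻¹ • Y)
    ((spectralNorm_smul_le (inv_nonneg.2 hpos.le) Y).trans_eq (inv_mul_cancel₀ hpos.ne'))
  rw [mInner_smul_right] at h
  field_simp at h
  linarith

lemma nuclearNorm_smul_le {c : ℝ} (hc : 0 ≤ c) (X : Matrix (Fin m) (Fin n) ℝ) :
    nuclearNorm (c • X) ≤ c * nuclearNorm X :=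
  nuclearNorm_le fun Y hY ↦ by
    rw [mInner_smul_left]
    exact mul_le_mul_of_nonneg_left (mInner_le_nuclearNorm X hY) hc

lemma nuclearNorm_vecMulVec_le_one {u : Fin m → ℝ} {v : Fin n → ℝ} (hu : u ⬝ᵥ u ≤ 1)
    (hv : v ⬝ᵥ v ≤ 1) : nuclearNorm (vecMulVec u v) ≤ 1 :=
  nuclearNorm_le fun Y hY ↦ by
    rw [mInner_vecMulVec]
    exact (dotProduct_mulVec_le_spectralNorm Y hu hv).trans hY

lemma mem_subdiff_spectralNorm {A Y : Matrix (Fin m) (Fin n) ℝ} :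
    Y ∈ subdiff spectralNorm A ↔ nuclearNorm Y ≤ 1 ∧ spectralNorm A ≤ mInner A Y := by
  constructor
  · intro h
    constructor
    · refine nuclearNorm_le fun Z hZ ↦ ?_
      have h1 := h (A + Z)
      rw [add_sub_cancel_left, mInner_comm] at h1
      linarith [spectralNorm_add_le A Z]
    · have h0 := h 0
      rw [mInner_sub_left, spectralNorm_zero] at h0
      simp only [mInner, Matrix.zero_apply, zero_mul, Finset.sum_const_zero] at h0 ⊢
      linarith
  · rintro ⟨h1, h2⟩ B
    rw [mInner_sub_left]
    have h := mInner_le_nuclearNorm_mul_spectralNorm Y B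
    rw [mInner_comm] at h
    have := mul_le_of_le_one_left (spectralNorm_nonneg B) h1
    linarith

lemma exists_dotProduct_mulVec_eq_spectralNorm (A : Matrix (Fin m) (Fin n) ℝ) :
    ∃ u v, u ⬝ᵥ u ≤ 1 ∧ v ⬝ᵥ v ≤ 1 ∧ u ⬝ᵥ A *ᵥ v = spectralNorm A := by
  have hK (k : ℕ) : IsCompact {u : Fin k → ℝ | u ⬝ᵥ u ≤ 1} := by
    refine (isCompact_closedBall (0 : Fin k → ℝ) 1).of_isClosed_subset
      (isClosed_le (by fun_prop) continuous_const) fun u hu ↦ ?_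
    rw [mem_closedBall_zero_iff, pi_norm_le_iff_of_nonneg zero_le_one]
    intro i
    have hi : u i * u i ≤ u ⬝ᵥ u := Finset.single_le_sum (f := fun i ↦ u i * u i)
      (fun i _ ↦ mul_self_nonneg (u i)) (Finset.mem_univ i)
    rw [Real.norm_eq_abs, ← sq_le_one_iff_abs_le_one, sq]
    exact hi.trans hu
  obtain ⟨⟨u, v⟩, ⟨hu, hv⟩, hmax⟩ := ((hK m).prod (hK n)).exists_isMaxOn
    ⟨(0, 0), by simp, by simp⟩
    (f := fun p : (Fin m → ℝ) × (Fin n → ℝ) ↦ p.1 ⬝ᵥ A *ᵥ p.2) (by fun_prop)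
  refine ⟨u, v, hu, hv, le_antisymm (dotProduct_mulVec_le_spectralNorm A hu hv) ?_⟩
  exact spectralNorm_le fun u' v' hu' hv' ↦ hmax (Set.mk_mem_prod hu' hv')

/-- A matrix of rank at most one annihilates a nontrivial combination of any two vectors. -/
lemma exists_mulVec_combination_eq_zero_of_rank_le_one {S : Matrix (Fin m) (Fin n) ℝ}
    (hS : S.rank ≤ 1) (v w : Fin n → ℝ) :
    ∃ a b : ℝ, 0 < a ^ 2 + b ^ 2 ∧ S *ᵥ (a • v + b • w) = 0 := by
  by_contra! h
  have hli : LinearIndependent ℝ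
      ![(⟨S *ᵥ v, v, rfl⟩ : S.mulVecLin.range), ⟨S *ᵥ w, w, rfl⟩] := by
    rw [LinearIndependent.pair_iff]
    intro a b hab
    have h0 : S *ᵥ (a • v + b • w) = 0 := by
      simpa [mulVec_add, mulVec_smul] using congrArg Subtype.val hab
    have hab' : ¬ 0 < a ^ 2 + b ^ 2 := fun hpos ↦ h a b hpos h0
    constructor <;> nlinarith [sq_nonneg a, sq_nonneg b]
  have hcard := hli.fintype_card_le_finrank
  rw [Fintype.card_fin] at hcard
  have : Module.finrank ℝ S.mulVecLin.range ≤ 1 := hS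
  omega

/-- Splitting `w` into its component along the unit vector `u` and an orthogonal remainder. -/
lemma exists_orthogonal_decomposition {k : ℕ} {u : Fin k → ℝ} (hu : u ⬝ᵥ u = 1)
    (w : Fin k → ℝ) :
    ∃ w', w = (u ⬝ᵥ w) • u + w' ∧ u ⬝ᵥ w' = 0 ∧ (u ⬝ᵥ w) ^ 2 + w' ⬝ᵥ w' = w ⬝ᵥ w := by
  refine ⟨w - (u ⬝ᵥ w) • u, by simp, by simp [dotProduct_sub, hu], ?_⟩
  simp only [dotProduct_sub, sub_dotProduct, smul_dotProduct, dotProduct_smul, hu,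
    dotProduct_comm w u, smul_eq_mul]
  ring

lemma vecMulVec_mulVec_real (u : Fin m → ℝ) (v w : Fin n → ℝ) :
    vecMulVec u v *ᵥ w = (v ⬝ᵥ w) • u := by
  ext i
  simp [vecMulVec_mulVec, mul_comm]

lemma spectralNorm_vecMulVec_add_le_one {u : Fin m → ℝ} {v : Fin n → ℝ} (hu : u ⬝ᵥ u = 1)
    (hv : v ⬝ᵥ v = 1) {C : Matrix (Fin m) (Fin n) ℝ} (hCv : C *ᵥ v = 0) (hCu : u ᵥ* C = 0)
    (hC : spectralNorm C ≤ 1) : spectralNorm (vecMulVec u v + C) ≤ 1 := by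
  refine spectralNorm_le fun x y hx hy ↦ ?_
  obtain ⟨x', hxe, -, hxn⟩ := exists_orthogonal_decomposition hu x
  obtain ⟨y', hye, -, hyn⟩ := exists_orthogonal_decomposition hv y
  have hCxy : x ⬝ᵥ C *ᵥ y = x' ⬝ᵥ C *ᵥ y' := by
    conv_lhs => rw [hxe, hye]
    simp [mulVec_add, mulVec_smul, hCv, dotProduct_mulVec, add_vecMul, smul_vecMul, hCu]
  rw [add_mulVec, dotProduct_add, vecMulVec_mulVec_real, dotProduct_smul, hCxy,
    dotProduct_comm x u, smul_eq_mul]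
  have h := two_mul_dotProduct_mulVec_le C x' y'
  have hx0 := dotProduct_self_nonneg_real x'
  have hy0 := dotProduct_self_nonneg_real y'
  have := mul_le_of_le_one_left (add_nonneg hx0 hy0) hC
  nlinarith [sq_nonneg (u ⬝ᵥ x - v ⬝ᵥ y)]

lemma eq_vecMulVec_of_nuclearNorm_le_one {u : Fin m → ℝ} {v : Fin n → ℝ} (hu : u ⬝ᵥ u = 1)
    (hv : v ⬝ᵥ v = 1) {Y : Matrix (Fin m) (Fin n) ℝ} (hY : nuclearNorm Y ≤ 1)
    (h : 1 ≤ u ⬝ᵥ Y *ᵥ v) : Y = vecMulVec u v := by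
  have hF : mInner Y Y ≤ √(mInner Y Y) :=
    (mInner_le_nuclearNorm_mul_spectralNorm Y Y).trans
      ((mul_le_of_le_one_left (spectralNorm_nonneg Y) hY).trans
        (spectralNorm_le_sqrt_mInner_self Y))
  have hF1 : mInner Y Y ≤ 1 := by
    have hsq := Real.sq_sqrt (mInner_self_nonneg Y)
    nlinarith [Real.sqrt_nonneg (mInner Y Y)]
  rw [← sub_eq_zero]
  apply eq_zero_of_mInner_self_le_zero
  have hW : mInner (vecMulVec u v) (vecMulVec u v) = 1 := by
    rw [mInner_vecMulVec, vecMulVec_mulVec_real, dotProduct_smul, hu, hv, smul_eq_mul, one_mul]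
  rw [mInner_sub_left, mInner_comm Y, mInner_comm (vecMulVec u v), mInner_sub_left,
    mInner_sub_left, hW, mInner_comm Y (vecMulVec u v), mInner_vecMulVec]
  linarith

section SingularPair

variable {A : Matrix (Fin m) (Fin n) ℝ} {u₁ : Fin m → ℝ} {v₁ : Fin n → ℝ}

lemma dotProduct_mulVec_singularPair (hu : u₁ ⬝ᵥ u₁ = 1) (hAv : A *ᵥ v₁ = spectralNorm A • u₁) :
    u₁ ⬝ᵥ A *ᵥ v₁ = spectralNorm A := by
  rw [hAv, dotProduct_smul, hu, smul_eq_mul, mul_one]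

lemma isOptMin_nuclearNorm_iff (hA : A ≠ 0) (hu : u₁ ⬝ᵥ u₁ = 1) (hv : v₁ ⬝ᵥ v₁ = 1)
    (hAv : A *ᵥ v₁ = spectralNorm A • u₁) {X : Matrix (Fin m) (Fin n) ℝ} :
    IsOptMin nuclearNorm A X ↔ 1 ≤ mInner A X ∧ nuclearNorm X ≤ (spectralNorm A)⁻¹ := by
  have hpos := spectralNorm_pos hA
  refine and_congr_right fun _ ↦ ⟨fun h ↦ ?_, fun h X' hX' ↦ h.trans ?_⟩
  · refine (h ((spectralNorm A)⁻¹ • vecMulVec u₁ v₁) ?_).trans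
      ((nuclearNorm_smul_le (inv_nonneg.2 hpos.le) _).trans
        (mul_le_of_le_one_right (inv_nonneg.2 hpos.le)
          (nuclearNorm_vecMulVec_le_one hu.le hv.le)))
    rw [mInner_smul_right, mInner_comm, mInner_vecMulVec, dotProduct_mulVec_singularPair hu hAv,
      inv_mul_cancel₀ hpos.ne']
  · have := mInner_le_nuclearNorm_mul_spectralNorm X' A
    rw [mInner_comm] at this
    rw [inv_le_iff_one_le_mul₀ hpos]
    exact hX'.trans this

lemma isOptMin_smul_vecMulVec (hA : A ≠ 0) (hu : u₁ ⬝ᵥ u₁ = 1) (hv : v₁ ⬝ᵥ v₁ = 1)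
    (hAv : A *ᵥ v₁ = spectralNorm A • u₁) {u : Fin m → ℝ} {v : Fin n → ℝ}
    (hu' : u ⬝ᵥ u ≤ 1) (hv' : v ⬝ᵥ v ≤ 1) (h : spectralNorm A ≤ u ⬝ᵥ A *ᵥ v) :
    IsOptMin nuclearNorm A ((spectralNorm A)⁻¹ • vecMulVec u v) := by
  have hpos := spectralNorm_pos hA
  rw [isOptMin_nuclearNorm_iff hA hu hv hAv]
  constructor
  · rw [mInner_smul_right, mInner_comm, mInner_vecMulVec, ← inv_mul_cancel₀ hpos.ne']
    exact mul_le_mul_of_nonneg_left h (inv_nonneg.2 hpos.le)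
  · exact (nuclearNorm_smul_le (inv_nonneg.2 hpos.le) _).trans
      (mul_le_of_le_one_right (inv_nonneg.2 hpos.le) (nuclearNorm_vecMulVec_le_one hu' hv'))

lemma isOptMin_nuclearNorm_iff_smul_mem_subdiff (hA : A ≠ 0) (hu : u₁ ⬝ᵥ u₁ = 1)
    (hv : v₁ ⬝ᵥ v₁ = 1) (hAv : A *ᵥ v₁ = spectralNorm A • u₁) {X : Matrix (Fin m) (Fin n) ℝ} :
    IsOptMin nuclearNorm A X ↔ spectralNorm A • X ∈ subdiff spectralNorm A := by
  have hpos := spectralNorm_pos hA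
  rw [isOptMin_nuclearNorm_iff hA hu hv hAv, mem_subdiff_spectralNorm, mInner_smul_right,
    and_comm, le_mul_iff_one_le_right hpos]
  refine and_congr_left fun _ ↦ ⟨fun h ↦ ?_, fun h ↦ ?_⟩
  · refine (nuclearNorm_smul_le hpos.le X).trans ?_
    rw [← mul_inv_cancel₀ hpos.ne']
    exact mul_le_mul_of_nonneg_left h hpos.le
  · have := nuclearNorm_smul_le (inv_nonneg.2 hpos.le) (spectralNorm A • X)
    rw [smul_smul, inv_mul_cancel₀ hpos.ne', one_smul] at this
    exact this.trans (mul_le_of_le_one_right (inv_nonneg.2 hpos.le) h)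

lemma deflation_mulVec (hv : v₁ ⬝ᵥ v₁ = 1) (hAv : A *ᵥ v₁ = spectralNorm A • u₁) :
    (A - spectralNorm A • vecMulVec u₁ v₁) *ᵥ v₁ = 0 := by
  rw [sub_mulVec, smul_mulVec, vecMulVec_mulVec_real, hv, one_smul, hAv, sub_self]

lemma vecMul_deflation (hu : u₁ ⬝ᵥ u₁ = 1) (hAu : Aᵀ *ᵥ u₁ = spectralNorm A • v₁) :
    u₁ ᵥ* (A - spectralNorm A • vecMulVec u₁ v₁) = 0 := by
  rw [vecMul_sub, vecMul_smul, vecMul_vecMulVec, hu, one_smul, ← mulVec_transpose, hAu, sub_self]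

/-- If deflating by a leading singular pair does not lower the spectral norm, there is a second
leading pair orthogonal to the first one. -/
lemma exists_orthogonal_singularPair (hu : u₁ ⬝ᵥ u₁ = 1) (hv : v₁ ⬝ᵥ v₁ = 1)
    (hAv : A *ᵥ v₁ = spectralNorm A • u₁) (hAu : Aᵀ *ᵥ u₁ = spectralNorm A • v₁)
    (h : spectralNorm A ≤ spectralNorm (A - spectralNorm A • vecMulVec u₁ v₁)) :
    ∃ u v, u₁ ⬝ᵥ u = 0 ∧ v₁ ⬝ᵥ v = 0 ∧ u ⬝ᵥ u ≤ 1 ∧ v ⬝ᵥ v ≤ 1 ∧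
      spectralNorm A ≤ u ⬝ᵥ A *ᵥ v := by
  obtain ⟨x, y, hx, hy, hxy⟩ :=
    exists_dotProduct_mulVec_eq_spectralNorm (A - spectralNorm A • vecMulVec u₁ v₁)
  obtain ⟨x', hxe, hxo, hxn⟩ := exists_orthogonal_decomposition hu x
  obtain ⟨y', hye, hyo, hyn⟩ := exists_orthogonal_decomposition hv y
  refine ⟨x', y', hxo, hyo, by nlinarith, by nlinarith, ?_⟩
  have hB : x ⬝ᵥ (A - spectralNorm A • vecMulVec u₁ v₁) *ᵥ y = x' ⬝ᵥ A *ᵥ y' := by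
    have hBy : (A - spectralNorm A • vecMulVec u₁ v₁) *ᵥ y = A *ᵥ y' := by
      conv_lhs => rw [hye]
      rw [mulVec_add, mulVec_smul, deflation_mulVec hv hAv, smul_zero, zero_add, sub_mulVec,
        smul_mulVec, vecMulVec_mulVec_real, hyo, zero_smul, smul_zero, sub_zero]
    have huy : u₁ ⬝ᵥ A *ᵥ y' = 0 := by
      rw [dotProduct_mulVec, ← mulVec_transpose, hAu, smul_dotProduct, hyo, smul_zero]
    rw [hBy]
    conv_lhs => rw [hxe]
    rw [add_dotProduct, smul_dotProduct, huy, smul_zero, zero_add]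
  rw [← hB, hxy]
  exact h

lemma spectralNorm_le_of_orthogonal_singularPair (hu : u₁ ⬝ᵥ u₁ = 1) (hv : v₁ ⬝ᵥ v₁ = 1)
    (hAv : A *ᵥ v₁ = spectralNorm A • u₁) (hAu : Aᵀ *ᵥ u₁ = spectralNorm A • v₁)
    {u : Fin m → ℝ} {v : Fin n → ℝ} (huo : u₁ ⬝ᵥ u = 0) (hvo : v₁ ⬝ᵥ v = 0)
    (hu' : u ⬝ᵥ u ≤ 1) (hv' : v ⬝ᵥ v ≤ 1) (h : spectralNorm A ≤ u ⬝ᵥ A *ᵥ v)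
    {S : Matrix (Fin m) (Fin n) ℝ} (hS : S.rank ≤ 1) :
    spectralNorm A ≤ spectralNorm (A - S) := by
  obtain ⟨a, b, hab, hS0⟩ := exists_mulVec_combination_eq_zero_of_rank_le_one hS v₁ v
  have hform := two_mul_dotProduct_mulVec_le (A - S) (a • u₁ + b • u) (a • v₁ + b • v)
  have huv : u₁ ⬝ᵥ A *ᵥ v = 0 := by
    rw [dotProduct_mulVec, ← mulVec_transpose, hAu, smul_dotProduct, hvo, smul_zero]
  have huo' : u ⬝ᵥ u₁ = 0 := by rw [dotProduct_comm, huo]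
  have hvo' : v ⬝ᵥ v₁ = 0 := by rw [dotProduct_comm, hvo]
  rw [sub_mulVec, hS0, sub_zero] at hform
  simp only [mulVec_add, mulVec_smul, hAv, add_dotProduct, dotProduct_add, smul_dotProduct,
    dotProduct_smul, smul_eq_mul, hu, hv, huo, hvo, huo', hvo', huv, mul_zero, mul_one,
    add_zero, zero_add] at hform
  have hb := mul_le_mul_of_nonneg_left h (sq_nonneg b)
  have hbu := mul_le_mul_of_nonneg_left hu' (sq_nonneg b)
  have hbv := mul_le_mul_of_nonneg_left hv' (sq_nonneg b)
  have hle : a * a + b * (b * (u ⬝ᵥ u)) + (a * a + b * (b * (v ⬝ᵥ v))) ≤ 2 * (a ^ 2 + b ^ 2) := by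
    linarith
  have := mul_le_mul_of_nonneg_left hle (spectralNorm_nonneg (A - S))
  refine le_of_mul_le_mul_right ?_ hab
  linarith

lemma spectralNorm_deflation_lt_iff (hu : u₁ ⬝ᵥ u₁ = 1) (hv : v₁ ⬝ᵥ v₁ = 1)
    (hAv : A *ᵥ v₁ = spectralNorm A • u₁) (hAu : Aᵀ *ᵥ u₁ = spectralNorm A • v₁) :
    spectralNorm (A - spectralNorm A • vecMulVec u₁ v₁) < spectralNorm A ↔
      sigma2 A < spectralNorm A := by
  constructor
  · intro h
    refine lt_of_le_of_lt ?_ h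
    refine csInf_le ⟨0, ?_⟩ ⟨spectralNorm A • vecMulVec u₁ v₁, ?_, rfl⟩
    · rintro _ ⟨S, -, rfl⟩
      exact spectralNorm_nonneg _
    · rw [← smul_vecMulVec]
      exact rank_vecMulVec_le _ _
  · intro h
    have hne : {r | ∃ S : Matrix (Fin m) (Fin n) ℝ, S.rank ≤ 1 ∧
        r = spectralNorm (A - S)}.Nonempty := ⟨_, 0, by simp, rfl⟩
    obtain ⟨_, ⟨S, hS, rfl⟩, hlt⟩ := exists_lt_of_csInf_lt hne h
    by_contra! hge
    obtain ⟨u, v, huo, hvo, hu', hv', huv⟩ := exists_orthogonal_singularPair hu hv hAv hAu hge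
    exact hlt.not_ge
      (spectralNorm_le_of_orthogonal_singularPair hu hv hAv hAu huo hvo hu' hv' huv hS)

lemma eq_vecMulVec_of_mem_subdiff (hu : u₁ ⬝ᵥ u₁ = 1) (hv : v₁ ⬝ᵥ v₁ = 1)
    (hAv : A *ᵥ v₁ = spectralNorm A • u₁) (hAu : Aᵀ *ᵥ u₁ = spectralNorm A • v₁)
    (hlt : spectralNorm (A - spectralNorm A • vecMulVec u₁ v₁) < spectralNorm A)
    {Y : Matrix (Fin m) (Fin n) ℝ} (hY : Y ∈ subdiff spectralNorm A) : Y = vecMulVec u₁ v₁ := by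
  obtain ⟨hY1, hYA⟩ := mem_subdiff_spectralNorm.1 hY
  refine eq_vecMulVec_of_nuclearNorm_le_one hu hv hY1 ?_
  obtain ⟨τ, hτ, hτA⟩ := exists_between hlt
  have hτ0 : 0 < τ := (spectralNorm_nonneg _).trans_lt hτ
  set B := A - spectralNorm A • vecMulVec u₁ v₁ with hB
  have hC : spectralNorm (vecMulVec u₁ v₁ + τ⁻¹ • B) ≤ 1 := by
    apply spectralNorm_vecMulVec_add_le_one hu hv
    · rw [smul_mulVec, deflation_mulVec hv hAv, smul_zero]
    · rw [vecMul_smul, vecMul_deflation hu hAu, smul_zero]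
    · refine (spectralNorm_smul_le (inv_nonneg.2 hτ0.le) B).trans ?_
      rw [← inv_mul_cancel₀ hτ0.ne']
      exact mul_le_mul_of_nonneg_left hτ.le (inv_nonneg.2 hτ0.le)
  have h1 := (mInner_le_nuclearNorm Y hC).trans hY1
  rw [mInner_comm, mInner_add_left, mInner_smul_left, mInner_vecMulVec] at h1
  have h2 : mInner A Y = mInner B Y + spectralNorm A * (u₁ ⬝ᵥ Y *ᵥ v₁) := by
    rw [hB, mInner_sub_left, mInner_smul_left, mInner_vecMulVec]
    ring
  have h3 : mInner B Y ≤ τ * (1 - u₁ ⬝ᵥ Y *ᵥ v₁) := by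
    rw [← inv_mul_le_iff₀ hτ0]
    linarith
  nlinarith

end SingularPair

theorem stmt4 (A : Matrix (Fin m) (Fin n) ℝ) (hA : A ≠ 0)
    (u₁ : Fin m → ℝ) (v₁ : Fin n → ℝ)
    (hu : (∑ i, u₁ i ^ 2) = 1) (hv : (∑ j, v₁ j ^ 2) = 1)
    (hAv : A.mulVec v₁ = spectralNorm A • u₁)
    (hAu : A.transpose.mulVec u₁ = spectralNorm A • v₁) :
    {X | IsOptMin nuclearNorm A X} = (spectralNorm A)⁻¹ • subdiff spectralNorm A ∧
      IsOptMin nuclearNorm A ((spectralNorm A)⁻¹ • Matrix.vecMulVec u₁ v₁) ∧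
      ((∀ X, IsOptMin nuclearNorm A X → X = (spectralNorm A)⁻¹ • Matrix.vecMulVec u₁ v₁) ↔
        sigma2 A < spectralNorm A) := by
  rw [sum_sq_eq_dotProduct_self] at hu hv
  have hpos := spectralNorm_pos hA
  refine ⟨?_, isOptMin_smul_vecMulVec hA hu hv hAv hu.le hv.le
    (dotProduct_mulVec_singularPair hu hAv).ge, ?_⟩
  · ext X
    rw [Set.mem_inv_smul_set_iff₀ hpos.ne', Set.mem_ofPred_eq,
      isOptMin_nuclearNorm_iff_smul_mem_subdiff hA hu hv hAv]
  rw [← spectralNorm_deflation_lt_iff hu hv hAv hAu]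
  constructor
  · intro h
    by_contra! hge
    obtain ⟨u, v, huo, -, hu', hv', huv⟩ := exists_orthogonal_singularPair hu hv hAv hAu hge
    have heq := smul_right_injective _ (inv_ne_zero hpos.ne')
      (h _ (isOptMin_smul_vecMulVec hA hu hv hAv hu' hv' huv))
    have h1 := congrArg (fun M ↦ u₁ ⬝ᵥ M *ᵥ v₁) heq
    simp [vecMulVec_mulVec_real, huo, hu, hv] at h1
  · intro hlt X hX
    rw [isOptMin_nuclearNorm_iff_smul_mem_subdiff hA hu hv hAv] at hX
    rw [← eq_vecMulVec_of_mem_subdiff hu hv hAv hAu hlt hX, inv_smul_smul₀ hpos.ne']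

end LAROS
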